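/- arXiv:math/0702698 — 3 statements merged into one kernel-verified Lean document; each statement's English description precedes it below -/
import Mathlib

section
/- Let u : [0, ∞) → ℝ be a twice differentiable solution of u(x) − x·u′(x) = u″(x)/(1 + u′(x)²) with u(0) > 0. Then the function x ↦ u(x)/x is strictly decreasing on (0, ∞). -/
/-- A solution on `[0, ∞)` of a linear equation `w' = -p w` with `p` continuous
stays positive if it starts positive. -/
theorem pos_of_hasDerivAt_neg_mul {w p : ℝ → ℝ} (hp : ContinuousOn p (Set.Ici 0))
    (hw : ∀ x : ℝ, 0 ≤ x → HasDerivAt w (-(p x * w x)) x) (h0 : 0 < w 0)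
    {x : ℝ} (hx : 0 ≤ x) : 0 < w x := by
  have hq : Continuous fun y : ℝ => p (max y 0) :=
    hp.comp_continuous (by fun_prop) fun y => le_max_right y 0
  have hG : ∀ y : ℝ, HasDerivAt (fun z => ∫ t in (0 : ℝ)..z, p (max t 0)) (p (max y 0)) y :=
    fun y => hq.integral_hasStrictDerivAt 0 y |>.hasDerivAt
  have hf : ∀ y : ℝ, 0 ≤ y →
      HasDerivAt (fun z => w z * Real.exp (∫ t in (0 : ℝ)..z, p (max t 0))) 0 y := by
    intro y hy
    refine ((hw y hy).mul (hG y).exp).congr_deriv ?_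
    rw [max_eq_left hy]
    ring
  have h := constant_of_has_deriv_right_zero
    (fun y hy => (hf y hy.1).continuousAt.continuousWithinAt)
    (fun y hy => (hf y hy.1).hasDerivWithinAt) x ⟨hx, le_rfl⟩
  simp only [intervalIntegral.integral_same, Real.exp_zero, mul_one] at h
  exact pos_of_mul_pos_left (h ▸ h0) (Real.exp_pos _).le

/-- For a twice differentiable solution of the self-expander ODE
on `[0, ∞)` with `u(0) > 0`, the function `x ↦ u(x)/x` is strictly decreasing
on `(0, ∞)`. -/
theorem self_expander_u_div_x_strictAnti
    (u : ℝ → ℝ)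
    (hu1 : ∀ x : ℝ, 0 ≤ x → DifferentiableAt ℝ u x)
    (hu2 : ∀ x : ℝ, 0 ≤ x → DifferentiableAt ℝ (deriv u) x)
    (hode : ∀ x : ℝ, 0 ≤ x →
      u x - x * deriv u x = deriv (deriv u) x / (1 + (deriv u x) ^ 2))
    (h0 : 0 < u 0) :
    StrictAntiOn (fun x => u x / x) (Set.Ioi (0 : ℝ)) := by
  have hcont : ContinuousOn (deriv u) (Set.Ici 0) :=
    fun x hx => (hu2 x hx).continuousAt.continuousWithinAt
  have hw : ∀ x : ℝ, 0 ≤ x → HasDerivAt (fun y => u y - y * deriv u y)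
      (-(x * (1 + deriv u x ^ 2) * (u x - x * deriv u x))) x := by
    intro x hx
    refine ((hu1 x hx).hasDerivAt.sub
      ((hasDerivAt_id x).mul (hu2 x hx).hasDerivAt)).congr_deriv ?_
    have hne : 1 + deriv u x ^ 2 ≠ 0 := by positivity
    rw [hode x hx, mul_assoc, mul_div_cancel₀ _ hne]
    simp only [id]
    ring
  have hpos : ∀ x : ℝ, 0 ≤ x → 0 < u x - x * deriv u x := fun x hx =>
    pos_of_hasDerivAt_neg_mul (w := fun y => u y - y * deriv u y)
      (p := fun y => y * (1 + deriv u y ^ 2)) (by fun_prop) hw (by simpa using h0) hx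
  have hd : ∀ x : ℝ, 0 < x →
      HasDerivAt (fun y => u y / y) ((deriv u x * x - u x * 1) / x ^ 2) x :=
    fun x hx => (hu1 x hx.le).hasDerivAt.div (hasDerivAt_id x) hx.ne'
  refine strictAntiOn_of_deriv_neg (convex_Ioi 0)
    (fun x hx => (hd x hx).continuousAt.continuousWithinAt) fun x hx => ?_
  rw [interior_Ioi] at hx
  have hx' : 0 < x := hx
  rw [(hd x hx).deriv]
  exact div_neg_of_neg_of_pos (by linarith [hpos x hx'.le]) (by positivity)
end

section
/- Let u, v : [0, ∞) → ℝ be twice differentiable solutions of w(x) − x·w′(x) = w″(x)/(1 + w′(x)²) with u(0) ≥ v(0) > 0 and u′(0) ≥ v′(0), but (u(0), u′(0)) ≠ (v(0), v′(0)). Then the asymptotic slopes satisfy the strict inequality lim_{x→∞} u(x)/x > lim_{x→∞} v(x)/x. -/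
open Filter

open Set Topology

theorem monotoneOn_Ici_of_hasDerivAt_nonneg {f f' : ℝ → ℝ} {a : ℝ}
    (hf : ∀ x, a ≤ x → HasDerivAt f (f' x) x) (hf' : ∀ x, a ≤ x → 0 ≤ f' x) :
    MonotoneOn f (Ici a) := by
  refine monotoneOn_of_deriv_nonneg (convex_Ici a)
    (fun x hx => (hf x hx).continuousAt.continuousWithinAt) ?_ ?_
  all_goals
    intro x hx
    rw [interior_Ici] at hx
  · exact (hf x (le_of_lt hx)).differentiableAt.differentiableWithinAt
  · rw [(hf x (le_of_lt hx)).deriv]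
    exact hf' x (le_of_lt hx)

theorem antitoneOn_Ici_of_hasDerivAt_nonpos {f f' : ℝ → ℝ} {a : ℝ}
    (hf : ∀ x, a ≤ x → HasDerivAt f (f' x) x) (hf' : ∀ x, a ≤ x → f' x ≤ 0) :
    AntitoneOn f (Ici a) := by
  have h := monotoneOn_Ici_of_hasDerivAt_nonneg (fun x hx => (hf x hx).neg)
    (fun x hx => neg_nonneg.2 (hf' x hx))
  exact fun x hx y hy hxy => neg_le_neg_iff.1 (h hx hy hxy)

/-- `u` solves the self-expander equation on `[0, ∞)`. -/
structure IsSelfExpander (u : ℝ → ℝ) : Prop where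
  differentiableAt : ∀ x : ℝ, 0 ≤ x → DifferentiableAt ℝ u x
  differentiableAt_deriv : ∀ x : ℝ, 0 ≤ x → DifferentiableAt ℝ (deriv u) x
  ode : ∀ x : ℝ, 0 ≤ x → u x - x * deriv u x = deriv (deriv u) x / (1 + (deriv u x) ^ 2)

/-- The height at the origin of the tangent line to the graph of `u` at `x`. -/
noncomputable def tangentIntercept (u : ℝ → ℝ) (x : ℝ) : ℝ := u x - x * deriv u x

namespace IsSelfExpander

variable {u v : ℝ → ℝ}

theorem hasDerivAt_deriv (h : IsSelfExpander u) {x : ℝ} (hx : 0 ≤ x) :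
    HasDerivAt (deriv u) ((1 + deriv u x ^ 2) * tangentIntercept u x) x := by
  have h2 : 1 + deriv u x ^ 2 ≠ 0 := by positivity
  refine (h.differentiableAt_deriv x hx).hasDerivAt.congr_deriv ?_
  rw [tangentIntercept, h.ode x hx, mul_div_cancel₀ _ h2]

theorem hasDerivAt_tangentIntercept (h : IsSelfExpander u) {x : ℝ} (hx : 0 ≤ x) :
    HasDerivAt (tangentIntercept u)
      (-(x * (1 + deriv u x ^ 2)) * tangentIntercept u x) x := by
  refine ((h.differentiableAt x hx).hasDerivAt.sub
    ((hasDerivAt_id x).mul (h.hasDerivAt_deriv hx))).congr_deriv ?_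
  simp only [id]
  ring

theorem hasDerivAt_arctan_deriv (h : IsSelfExpander u) {x : ℝ} (hx : 0 ≤ x) :
    HasDerivAt (fun y => Real.arctan (deriv u y)) (tangentIntercept u x) x := by
  have h2 : 1 + deriv u x ^ 2 ≠ 0 := by positivity
  refine (h.hasDerivAt_deriv hx).arctan.congr_deriv ?_
  field_simp

theorem hasDerivAt_div_id (h : IsSelfExpander u) {x : ℝ} (hx : 0 < x) :
    HasDerivAt (fun y => u y / y) (-tangentIntercept u x / x ^ 2) x := by
  refine ((h.differentiableAt x hx.le).hasDerivAt.div (hasDerivAt_id x) hx.ne').congr_deriv ?_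
  simp only [id, tangentIntercept]
  ring

theorem tangentIntercept_pos (h : IsSelfExpander u) (h0 : 0 < u 0) {x : ℝ} (hx : 0 ≤ x) :
    0 < tangentIntercept u x := by
  have hc : Continuous fun t : ℝ => t * (1 + deriv u (max t 0) ^ 2) := by
    have : Continuous fun t : ℝ => deriv u (max t 0) :=
      continuous_iff_continuousAt.2 fun t =>
        ContinuousAt.comp (f := fun t : ℝ => max t 0)
          (h.differentiableAt_deriv _ (le_max_right _ _)).continuousAt (by fun_prop)
    fun_prop
  have hF (y : ℝ) := intervalIntegral.integral_hasDerivAt_right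
    (hc.intervalIntegrable 0 y) hc.aestronglyMeasurable.stronglyMeasurableAtFilter
    hc.continuousAt
  have hm := monotoneOn_Ici_of_hasDerivAt_nonneg (a := 0)
    (fun y hy => (h.hasDerivAt_tangentIntercept hy).mul (hF y).exp) (fun y hy => by
      rw [max_eq_left hy]
      exact le_of_eq (by ring))
  have := hm self_mem_Ici hx hx
  simp only [Pi.mul_apply, intervalIntegral.integral_same, Real.exp_zero, mul_one] at this
  have h1 : tangentIntercept u 0 = u 0 := by simp [tangentIntercept]
  rw [h1] at this
  exact pos_of_mul_pos_left (h0.trans_le this) (Real.exp_pos _).le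

theorem deriv_monotoneOn (h : IsSelfExpander u) (h0 : 0 < u 0) :
    MonotoneOn (deriv u) (Ici 0) :=
  monotoneOn_Ici_of_hasDerivAt_nonneg (fun _ hx => h.hasDerivAt_deriv hx)
    fun _ hx => mul_nonneg (by positivity) (h.tangentIntercept_pos h0 hx).le

theorem tangentIntercept_le (h : IsSelfExpander u) (h0 : 0 < u 0) {x : ℝ} (hx : 0 ≤ x) :
    tangentIntercept u x ≤ u 0 := by
  have := antitoneOn_Ici_of_hasDerivAt_nonpos
    (fun _ hx => h.hasDerivAt_tangentIntercept hx)
    (fun y hy => mul_nonpos_of_nonpos_of_nonneg (neg_nonpos.2 (by positivity))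
      (h.tangentIntercept_pos h0 hy).le) self_mem_Ici hx hx
  simpa [tangentIntercept] using this

theorem exists_tendsto_div_id (h : IsSelfExpander u) (h0 : 0 < u 0) :
    ∃ a, Tendsto (fun x => u x / x) atTop (𝓝 a) := by
  have hanti : AntitoneOn (fun x => u x / x) (Ici 1) :=
    antitoneOn_Ici_of_hasDerivAt_nonpos
      (fun x hx => h.hasDerivAt_div_id (zero_lt_one.trans_le hx)) fun x hx => by
        have := h.tangentIntercept_pos h0 (zero_le_one.trans hx)
        exact div_nonpos_of_nonpos_of_nonneg (by linarith) (by positivity)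
  have hanti' : Antitone fun x : ℝ => u (max x 1) / max x 1 := fun x y hxy =>
    hanti (le_max_right x 1) (le_max_right y 1) (max_le_max_right 1 hxy)
  have hbdd : BddBelow (range fun x : ℝ => u (max x 1) / max x 1) := by
    refine ⟨deriv u 0, ?_⟩
    rintro _ ⟨x, rfl⟩
    have hx : 0 < max x 1 := zero_lt_one.trans_le (le_max_right _ _)
    have h1 := h.tangentIntercept_pos h0 hx.le
    have h2 := h.deriv_monotoneOn h0 self_mem_Ici hx.le hx.le
    rw [tangentIntercept] at h1
    refine h2.trans ((le_div_iff₀ hx).2 ?_)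
    linarith
  refine ⟨_, (tendsto_atTop_ciInf hanti' hbdd).congr' ?_⟩
  filter_upwards [eventually_ge_atTop 1] with x hx
  rw [max_eq_left hx]

theorem tendsto_deriv (h : IsSelfExpander u) (h0 : 0 < u 0) {a : ℝ}
    (ha : Tendsto (fun x => u x / x) atTop (𝓝 a)) : Tendsto (deriv u) atTop (𝓝 a) := by
  have hW : Tendsto (fun x => tangentIntercept u x / x) atTop (𝓝 0) := by
    refine squeeze_zero' ?_ ?_ (tendsto_id.const_div_atTop (u 0))
    all_goals filter_upwards [eventually_ge_atTop 0] with x hx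
    · exact div_nonneg (h.tangentIntercept_pos h0 hx).le hx
    · exact div_le_div_of_nonneg_right (h.tangentIntercept_le h0 hx) hx
  have := ha.sub hW
  rw [sub_zero] at this
  refine this.congr' ?_
  filter_upwards [eventually_gt_atTop 0] with x hx
  rw [tangentIntercept]
  field_simp
  ring

theorem deriv_lt_deriv (hu : IsSelfExpander u) (hv : IsSelfExpander v)
    (hheight : v 0 ≤ u 0) (hslope : deriv v 0 ≤ deriv u 0)
    (hne : (u 0, deriv u 0) ≠ (v 0, deriv v 0)) {x : ℝ} (hx : 0 < x) :
    deriv v x < deriv u x ∧ v x < u x := by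
  have hd {y : ℝ} (hy : 0 ≤ y) : HasDerivAt (fun z => u z - v z) (deriv u y - deriv v y) y :=
    (hu.differentiableAt y hy).hasDerivAt.sub (hv.differentiableAt y hy).hasDerivAt
  have hd' {y : ℝ} (hy : 0 ≤ y) : HasDerivAt (fun z => deriv u z - deriv v z)
      ((1 + deriv u y ^ 2) * tangentIntercept u y
        - (1 + deriv v y ^ 2) * tangentIntercept v y) y :=
    (hu.hasDerivAt_deriv hy).sub (hv.hasDerivAt_deriv hy)
  have hd'_pos {y : ℝ} (hy : deriv u y = deriv v y) (hlt : v y < u y) :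
      0 < (1 + deriv u y ^ 2) * tangentIntercept u y
        - (1 + deriv v y ^ 2) * tangentIntercept v y := by
    have : 0 < (1 + deriv v y ^ 2) * (u y - v y) := mul_pos (by positivity) (by linarith)
    simp only [tangentIntercept, hy]
    linarith
  have hstart : ∃ ε > 0, ∀ y, 0 < y → y < ε → deriv v y < deriv u y := by
    suffices ∀ᶠ y in 𝓝[>] (0 : ℝ), 0 < deriv u y - deriv v y by
      obtain ⟨ε, hε, hsub⟩ := mem_nhdsGT_iff_exists_Ioo_subset.1 this
      exact ⟨ε, hε, fun y h1 h2 => sub_pos.1 (hsub ⟨h1, h2⟩)⟩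
    rcases hslope.lt_or_eq with hlt | heq
    · exact ((hd' le_rfl).continuousAt.eventually_const_lt (sub_pos.2 hlt)).filter_mono
        nhdsWithin_le_nhds
    · have hlt : v 0 < u 0 := hheight.lt_of_ne fun h => hne (by rw [h, heq])
      have hs := (hasDerivAt_iff_tendsto_slope.1 (hd' le_rfl)).eventually_const_lt
        (hd'_pos heq.symm hlt)
      filter_upwards [hs.filter_mono (nhdsWithin_mono _ fun y (hy : 0 < y) => hy.ne'),
        self_mem_nhdsWithin] with y hy hy0
      rw [slope_def_field, heq, sub_self, sub_zero, sub_zero] at hy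
      exact (div_pos_iff_of_pos_right hy0).1 hy
  have hlt_of {t : ℝ} (ht : 0 < t) (hpos : ∀ y, 0 < y → y < t → deriv v y < deriv u y) :
      v t < u t := by
    have hmono : StrictMonoOn (fun z => u z - v z) (Icc 0 t) := by
      refine strictMonoOn_of_deriv_pos (convex_Icc 0 t)
        (fun y hy => (hd hy.1).continuousAt.continuousWithinAt) fun y hy => ?_
      rw [interior_Icc] at hy
      rw [(hd hy.1.le).deriv]
      exact sub_pos.2 (hpos y hy.1 hy.2)
    have := hmono ⟨le_rfl, ht.le⟩ ⟨ht.le, le_rfl⟩ ht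
    simp only at this
    linarith
  have hall : ∀ y, 0 < y → deriv v y < deriv u y := by
    by_contra! hbad
    obtain ⟨T, hT, hTle⟩ := hbad
    obtain ⟨ε, hε, hεpos⟩ := hstart
    have hεT : ε ≤ T := not_lt.1 fun h => (hεpos T hT h).not_ge hTle
    have hcompact : IsCompact (Icc ε T ∩ (fun z => deriv u z - deriv v z) ⁻¹' Iic 0) := by
      refine isCompact_Icc.of_isClosed_subset
        (ContinuousOn.preimage_isClosed_of_isClosed (fun y hy => ?_) isClosed_Icc isClosed_Iic)
        inter_subset_left
      exact (hd' (hε.le.trans hy.1)).continuousAt.continuousWithinAt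
    obtain ⟨t, ⟨⟨hεt, htT⟩, htle⟩, hleast⟩ :=
      hcompact.exists_isLeast ⟨T, ⟨hεT, le_rfl⟩, sub_nonpos.2 hTle⟩
    have ht : 0 < t := lt_of_lt_of_le hε hεt
    have hbefore : ∀ y, 0 < y → y < t → deriv v y < deriv u y := by
      intro y hy hyt
      by_contra! hle
      have hεy : ε ≤ y := not_lt.1 fun h => (hεpos y hy h).not_ge hle
      exact hyt.not_ge (hleast ⟨⟨hεy, hyt.le.trans htT⟩, sub_nonpos.2 hle⟩)
    have hev : ∀ᶠ y in 𝓝[<] t, 0 < deriv u y - deriv v y := by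
      filter_upwards [Ioo_mem_nhdsLT ht] with y hy
      exact sub_pos.2 (hbefore y hy.1 hy.2)
    have hzero : deriv u t - deriv v t = 0 := by
      have hlim : Tendsto (fun z => deriv u z - deriv v z) (𝓝[<] t)
          (𝓝 (deriv u t - deriv v t)) :=
        (hd' ht.le).continuousAt.tendsto.mono_left nhdsWithin_le_nhds
      exact le_antisymm htle (ge_of_tendsto hlim (hev.mono fun y hy => hy.le))
    have hs := (hasDerivAt_iff_tendsto_slope.1 (hd' ht.le)).eventually_const_lt
      (hd'_pos (sub_eq_zero.1 hzero) (hlt_of ht hbefore))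
    have hs' := hs.filter_mono (nhdsWithin_mono t fun y (hy : y ∈ Iio t) => ne_of_lt hy)
    obtain ⟨y, ⟨hy1, hy2⟩, hyt⟩ := ((hs'.and hev).and self_mem_nhdsWithin).exists
    rw [slope_def_field, hzero, sub_zero] at hy1
    exact (div_neg_of_pos_of_neg hy2 (sub_neg.2 hyt)).not_gt hy1
  exact ⟨hall x hx, hlt_of hx fun y hy _ => hall y hy⟩

theorem hasDerivAt_tangentIntercept_div (hu : IsSelfExpander u) (hv : IsSelfExpander v)
    (hv0 : 0 < v 0) {x : ℝ} (hx : 0 ≤ x) :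
    HasDerivAt (fun y => tangentIntercept u y / tangentIntercept v y)
      (-(x * (tangentIntercept u x / tangentIntercept v x) * (deriv u x - deriv v x)
        * (deriv u x + deriv v x))) x := by
  have hne := (hv.tangentIntercept_pos hv0 hx).ne'
  refine ((hu.hasDerivAt_tangentIntercept hx).div
    (hv.hasDerivAt_tangentIntercept hx) hne).congr_deriv ?_
  field_simp
  ring

/-- The angle between the graphs does not shrink where `u` has the larger tangent intercept. -/
theorem slope_lt_of_tangentIntercept_le (hu : IsSelfExpander u) (hv : IsSelfExpander v)
    {a b x₀ : ℝ} (ha : Tendsto (deriv u) atTop (𝓝 a)) (hb : Tendsto (deriv v) atTop (𝓝 b))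
    (hx₀ : 0 ≤ x₀) (hlt : deriv v x₀ < deriv u x₀)
    (hle : ∀ x, x₀ ≤ x → tangentIntercept v x ≤ tangentIntercept u x) : b < a := by
  have hmono : MonotoneOn (fun x => Real.arctan (deriv u x) - Real.arctan (deriv v x))
      (Ici x₀) :=
    monotoneOn_Ici_of_hasDerivAt_nonneg
      (fun x hx => (hu.hasDerivAt_arctan_deriv (hx₀.trans hx)).sub
        (hv.hasDerivAt_arctan_deriv (hx₀.trans hx)))
      fun x hx => sub_nonneg.2 (hle x hx)
  have hlim := ge_of_tendsto
    (((Real.continuous_arctan.tendsto a).comp ha).sub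
      ((Real.continuous_arctan.tendsto b).comp hb))
    ((eventually_ge_atTop x₀).mono fun x hx => hmono self_mem_Ici hx hx)
  have := Real.arctan_strictMono hlt
  exact Real.arctan_strictMono.lt_iff_lt.1 (by linarith)

/-- The quotient `(u - v) / x` increases where `u` has the smaller tangent intercept. -/
theorem slope_lt_of_le_tangentIntercept (hu : IsSelfExpander u) (hv : IsSelfExpander v)
    {a b x₀ : ℝ} (ha : Tendsto (fun x => u x / x) atTop (𝓝 a))
    (hb : Tendsto (fun x => v x / x) atTop (𝓝 b)) (hx₀ : 0 < x₀) (hlt : v x₀ < u x₀)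
    (hle : ∀ x, x₀ ≤ x → tangentIntercept u x ≤ tangentIntercept v x) : b < a := by
  have hmono : MonotoneOn (fun x => u x / x - v x / x) (Ici x₀) :=
    monotoneOn_Ici_of_hasDerivAt_nonneg
      (fun x hx => (hu.hasDerivAt_div_id (hx₀.trans_le hx)).sub
        (hv.hasDerivAt_div_id (hx₀.trans_le hx)))
      fun x hx => by
        rw [← sub_div]
        exact div_nonneg (by linarith [hle x hx]) (by positivity)
  have hlim := ge_of_tendsto (ha.sub hb)
    ((eventually_ge_atTop x₀).mono fun x hx => hmono self_mem_Ici hx hx)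
  have := div_lt_div_of_pos_right hlt hx₀
  simp only at hlim
  linarith

theorem slope_lt (hu : IsSelfExpander u) (hv : IsSelfExpander v) (hv0 : 0 < v 0)
    (hheight : v 0 ≤ u 0) (hslope : deriv v 0 ≤ deriv u 0)
    (hne : (u 0, deriv u 0) ≠ (v 0, deriv v 0)) {a b : ℝ}
    (ha : Tendsto (fun x => u x / x) atTop (𝓝 a))
    (hb : Tendsto (fun x => v x / x) atTop (𝓝 b)) : b < a := by
  have hu0 : 0 < u 0 := hv0.trans_le hheight
  have hcmp {x : ℝ} (hx : 0 < x) := hu.deriv_lt_deriv hv hheight hslope hne hx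
  have hdle {x : ℝ} (hx : 0 ≤ x) : 0 ≤ deriv u x - deriv v x := by
    rcases hx.eq_or_lt with rfl | hx
    · exact sub_nonneg.2 hslope
    · exact (sub_pos.2 (hcmp hx).1).le
  have ha' := hu.tendsto_deriv hu0 ha
  have hb' := hv.tendsto_deriv hv0 hb
  have hcoef {x : ℝ} (hx : 0 ≤ x) : 0 ≤ x * (tangentIntercept u x / tangentIntercept v x)
      * (deriv u x - deriv v x) :=
    mul_nonneg (mul_nonneg hx (div_pos (hu.tangentIntercept_pos hu0 hx)
      (hv.tangentIntercept_pos hv0 hx)).le) (hdle hx)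
  by_cases hsum : ∃ x₀ > 0, 0 ≤ deriv u x₀ + deriv v x₀
  · obtain ⟨x₀, hx₀, hsum⟩ := hsum
    have hanti : AntitoneOn (fun x => tangentIntercept u x / tangentIntercept v x) (Ici x₀) :=
      antitoneOn_Ici_of_hasDerivAt_nonpos
        (fun x hx => hu.hasDerivAt_tangentIntercept_div hv hv0 (hx₀.le.trans hx))
        fun x hx => neg_nonpos.2 (mul_nonneg (hcoef (hx₀.le.trans hx)) (hsum.trans (add_le_add
          (hu.deriv_monotoneOn hu0 hx₀.le (hx₀.le.trans hx) hx)
          (hv.deriv_monotoneOn hv0 hx₀.le (hx₀.le.trans hx) hx))))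
    by_cases hle : ∀ x, x₀ ≤ x → tangentIntercept v x ≤ tangentIntercept u x
    · exact hu.slope_lt_of_tangentIntercept_le hv ha' hb' hx₀.le (hcmp hx₀).1 hle
    · push Not at hle
      obtain ⟨x₁, hx₁, hlt⟩ := hle
      have hx₁0 : 0 < x₁ := hx₀.trans_le hx₁
      refine hu.slope_lt_of_le_tangentIntercept hv ha hb hx₁0 (hcmp hx₁0).2 fun x hx => ?_
      have hratio := hanti hx₁ (hx₁.trans hx) hx
      have h1 := (div_lt_one (hv.tangentIntercept_pos hv0 hx₁0.le)).2 hlt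
      exact (div_le_one (hv.tangentIntercept_pos hv0 (hx₁0.le.trans hx))).1
        (hratio.trans h1.le)
  · push Not at hsum
    have hsum' {x : ℝ} (hx : 0 ≤ x) : deriv u x + deriv v x ≤ 0 :=
      (add_le_add (hu.deriv_monotoneOn hu0 hx (mem_Ici.2 (by linarith : 0 ≤ x + 1)) (by linarith))
        (hv.deriv_monotoneOn hv0 hx (mem_Ici.2 (by linarith : 0 ≤ x + 1)) (by linarith))).trans
        (hsum (x + 1) (by linarith)).le
    have hmono : MonotoneOn (fun x => tangentIntercept u x / tangentIntercept v x) (Ici 0) :=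
      monotoneOn_Ici_of_hasDerivAt_nonneg
        (fun x hx => hu.hasDerivAt_tangentIntercept_div hv hv0 hx)
        fun x hx => neg_nonneg.2 (mul_nonpos_of_nonneg_of_nonpos (hcoef hx) (hsum' hx))
    refine hu.slope_lt_of_tangentIntercept_le hv ha' hb' zero_le_one (hcmp one_pos).1
      fun x hx => ?_
    have hx0 : 0 ≤ x := zero_le_one.trans hx
    have h0 : 1 ≤ tangentIntercept u 0 / tangentIntercept v 0 := by
      rw [one_le_div (hv.tangentIntercept_pos hv0 le_rfl)]
      simpa [tangentIntercept] using hheight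
    exact (one_le_div (hv.tangentIntercept_pos hv0 hx0)).1
      (h0.trans (hmono self_mem_Ici hx0 hx0))

end IsSelfExpander

/-- For two solutions of the self-expander ODE with
`u(0) ≥ v(0) > 0`, `u'(0) ≥ v'(0)` and `(u(0), u'(0)) ≠ (v(0), v'(0))`, the
asymptotic slopes `lim_{x→∞} u(x)/x` and `lim_{x→∞} v(x)/x` exist and satisfy
the strict inequality `lim u(x)/x > lim v(x)/x`. -/
theorem self_expander_asymptotic_slope_strict_mono
    (u v : ℝ → ℝ)
    (hu1 : ∀ x : ℝ, 0 ≤ x → DifferentiableAt ℝ u x)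
    (hu2 : ∀ x : ℝ, 0 ≤ x → DifferentiableAt ℝ (deriv u) x)
    (hodeu : ∀ x : ℝ, 0 ≤ x →
      u x - x * deriv u x = deriv (deriv u) x / (1 + (deriv u x) ^ 2))
    (hv1 : ∀ x : ℝ, 0 ≤ x → DifferentiableAt ℝ v x)
    (hv2 : ∀ x : ℝ, 0 ≤ x → DifferentiableAt ℝ (deriv v) x)
    (hodev : ∀ x : ℝ, 0 ≤ x →
      v x - x * deriv v x = deriv (deriv v) x / (1 + (deriv v x) ^ 2))
    (hv0 : 0 < v 0) (hheight : v 0 ≤ u 0) (hslope : deriv v 0 ≤ deriv u 0)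
    (hne : (u 0, deriv u 0) ≠ (v 0, deriv v 0)) :
    ∃ au av : ℝ,
      Tendsto (fun x => u x / x) atTop (nhds au) ∧
      Tendsto (fun x => v x / x) atTop (nhds av) ∧
      av < au := by
  have hu : IsSelfExpander u := ⟨hu1, hu2, hodeu⟩
  have hv : IsSelfExpander v := ⟨hv1, hv2, hodev⟩
  obtain ⟨au, hau⟩ := hu.exists_tendsto_div_id (hv0.trans_le hheight)
  obtain ⟨av, hav⟩ := hv.exists_tendsto_div_id hv0
  exact ⟨au, av, hau, hav, hu.slope_lt hv hv0 hheight hslope hne hau hav⟩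
end

section
/- Let h > 0 and let u : [0, ∞) → ℝ be a twice differentiable solution of u(x) − x·u′(x) = u″(x)/(1 + u′(x)²) with u(0) = h and u′(0) = 0. Then u′(1/2) ≥ h/4. -/
/-- A function satisfying `w' = -a w` on `[0, b]`, with `a` bounded above and `w 0 > 0`,
is positive on `[0, b]`. -/
theorem pos_of_hasDerivAt_neg_mul_s13 {w a : ℝ → ℝ} {b M : ℝ}
    (hw : ∀ x ∈ Set.Icc 0 b, HasDerivAt w (-(a x * w x)) x)
    (ha : ∀ x ∈ Set.Icc 0 b, a x ≤ M) (h0 : 0 < w 0) :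
    ∀ x ∈ Set.Icc 0 b, 0 < w x := by
  have hd : ∀ x ∈ Set.Icc 0 b, HasDerivAt (fun y => w y ^ 2 * Real.exp (2 * M * y))
      (2 * (M - a x) * (w x ^ 2 * Real.exp (2 * M * x))) x := by
    intro x hx
    have h := ((hw x hx).pow 2).mul (((hasDerivAt_id x).const_mul (2 * M)).exp)
    refine h.congr_deriv ?_
    simp
    ring
  have hmono : MonotoneOn (fun y => w y ^ 2 * Real.exp (2 * M * y)) (Set.Icc 0 b) := by
    refine monotoneOn_of_hasDerivWithinAt_nonneg (convex_Icc 0 b)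
      (fun x hx => (hd x hx).continuousAt.continuousWithinAt)
      (fun x hx => (hd x (interior_subset hx)).hasDerivWithinAt) fun x hx => ?_
    have := sub_nonneg.2 (ha x (interior_subset hx))
    positivity
  intro x hx
  by_contra! hneg
  have hcont : ContinuousOn w (Set.Icc 0 x) := fun y hy =>
    (hw y ⟨hy.1, hy.2.trans hx.2⟩).continuousAt.continuousWithinAt
  obtain ⟨z, hz, hwz⟩ := intermediate_value_Icc' hx.1 hcont ⟨hneg, h0.le⟩
  have h := hmono ⟨le_rfl, hx.1.trans hx.2⟩ ⟨hz.1, hz.2.trans hx.2⟩ hz.1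
  simp only [hwz, mul_zero, Real.exp_zero, mul_one] at h
  nlinarith


/-- A solution of the self-expander ODE with `u(0) = h > 0` and
`u'(0) = 0` satisfies `u'(1/2) ≥ h/4`. -/
theorem self_expander_slope_at_half
    (h : ℝ) (hh : 0 < h) (u : ℝ → ℝ)
    (hu1 : ∀ x : ℝ, 0 ≤ x → DifferentiableAt ℝ u x)
    (hu2 : ∀ x : ℝ, 0 ≤ x → DifferentiableAt ℝ (deriv u) x)
    (hode : ∀ x : ℝ, 0 ≤ x →
      u x - x * deriv u x = deriv (deriv u) x / (1 + (deriv u x) ^ 2))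
    (h0 : u 0 = h) (h0' : deriv u 0 = 0) :
    h / 4 ≤ deriv u (1 / 2) := by
  have hu'' : ∀ x, 0 ≤ x →
      deriv (deriv u) x = (u x - x * deriv u x) * (1 + deriv u x ^ 2) := by
    intro x hx
    rw [hode x hx, div_mul_cancel₀]
    positivity
  have hvcont : ContinuousOn (deriv u) (Set.Icc 0 (1 / 2)) := fun x hx =>
    (hu2 x hx.1).continuousAt.continuousWithinAt
  obtain ⟨M, hM⟩ := (isCompact_Icc (a := (0 : ℝ)) (b := 1 / 2)).bddAbove_image
    (f := fun x => x * (1 + deriv u x ^ 2)) (by fun_prop)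
  have hw : ∀ x ∈ Set.Icc (0 : ℝ) (1 / 2), 0 < u x - x * deriv u x := by
    refine pos_of_hasDerivAt_neg_mul_s13 (w := fun x => u x - x * deriv u x)
      (a := fun x => x * (1 + deriv u x ^ 2)) (M := M) (fun x hx => ?_)
      (fun x hx => hM (Set.mem_image_of_mem _ hx)) (by simpa [h0] using hh)
    have h := (hu1 x hx.1).hasDerivAt.sub ((hasDerivAt_id x).mul (hu2 x hx.1).hasDerivAt)
    refine h.congr_deriv ?_
    simp only [id_eq, hu'' x hx.1]
    ring
  have hvmono : MonotoneOn (deriv u) (Set.Icc 0 (1 / 2)) := by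
    refine monotoneOn_of_deriv_nonneg (convex_Icc _ _) hvcont
      (fun x hx => (hu2 x (interior_subset hx).1).differentiableWithinAt) fun x hx => ?_
    have hx := interior_subset hx
    have := hw x hx
    rw [hu'' x hx.1]
    positivity
  have hv0 : ∀ x ∈ Set.Icc (0 : ℝ) (1 / 2), 0 ≤ deriv u x := fun x hx =>
    h0' ▸ hvmono ⟨le_rfl, by norm_num⟩ hx hx.1
  have humono : MonotoneOn u (Set.Icc 0 (1 / 2)) :=
    monotoneOn_of_deriv_nonneg (convex_Icc _ _)
      (fun x hx => (hu1 x hx.1).continuousAt.continuousWithinAt)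
      (fun x hx => (hu1 x (interior_subset hx).1).differentiableWithinAt)
      fun x hx => hv0 x (interior_subset hx)
  by_contra! hlt
  obtain ⟨c, hc, hslope⟩ := exists_deriv_eq_slope (deriv u) (by norm_num : (0 : ℝ) < 1 / 2)
    hvcont fun x hx => (hu2 x hx.1.le).differentiableWithinAt
  have hc := Set.Ioo_subset_Icc_self hc
  have hvc : deriv u c ≤ deriv u (1 / 2) := hvmono hc ⟨by norm_num, le_rfl⟩ hc.2
  have huc : h ≤ u c := h0 ▸ humono ⟨le_rfl, by norm_num⟩ hc hc.1
  have hcv : c * deriv u c ≤ 1 / 2 * (h / 4) :=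
    mul_le_mul hc.2 (hvc.trans hlt.le) (hv0 c hc) (by norm_num)
  have hle : u c - c * deriv u c ≤ deriv (deriv u) c := by
    rw [hu'' c hc.1]
    nlinarith [mul_nonneg (hw c hc).le (sq_nonneg (deriv u c))]
  rw [hslope, h0'] at hle
  norm_num at hle hlt
  linarith
end
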